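/- arXiv:2205.05280 — 4 statements merged into one kernel-verified Lean document; each statement's English description precedes it below -/
import Mathlib

section
/- Let t₁, t₂, t₃ > 0 and α ∈ (q,1). Then ∫_ℝ (−q t₁ z, q t₁/z, −q t₂ z, q t₂/z, −q t₃ z, q t₃/z;q)_∞ dμ_α(x) = (−q t₁ t₂, −q t₁ t₃, −q t₂ t₃;q)_∞, where z = z(x); explicitly, Σ_{n∈ℤ} ∏_{j=1}^{3}(−q t_j q^{−n}/α, q t_j α q^{n};q)_∞ · m_n(α) = (−q t₁ t₂, −q t₁ t₃, −q t₂ t₃;q)_∞. -/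
noncomputable section

open scoped BigOperators
open Finset MeasureTheory Filter Topology

/-- The finite q-shifted factorial `(a;q)_n`. -/
def qp (q a : ℝ) (n : ℕ) : ℝ := ∏ j ∈ Finset.range n, (1 - a * q ^ j)

/-- The infinite q-shifted factorial `(a;q)_∞`. -/
def qpi (q a : ℝ) : ℝ := ∏' j : ℕ, (1 - a * q ^ j)

/-- `z(x) = x + √(x²+1)`, so that `2x = z - 1/z`. -/
def zx (x : ℝ) : ℝ := x + Real.sqrt (x ^ 2 + 1)

/-- The Askey–Wilson type polynomial `p_n(x, t)`. -/
def pAW (q t1 t2 t3 t4 : ℝ) (n : ℕ) (x : ℝ) : ℝ :=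
  (t1 / q) ^ n * qp q (-q ^ 2 / (t1 * t2)) n * qp q (-q ^ 2 / (t1 * t3)) n *
    qp q (-q ^ 2 / (t1 * t4)) n *
  ∑ k ∈ Finset.range (n + 1),
    qp q (q ^ (-(n : ℤ))) k * qp q (q ^ (n + 3) / (t1 * t2 * t3 * t4)) k *
      qp q (-q / (t1 * zx x)) k * qp q (q * zx x / t1) k * q ^ k /
    (qp q q k * qp q (-q ^ 2 / (t1 * t2)) k * qp q (-q ^ 2 / (t1 * t3)) k *
      qp q (-q ^ 2 / (t1 * t4)) k)

/-- The normalized weight function `w(x, t)`. -/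
def wAW (q t1 t2 t3 t4 : ℝ) (x : ℝ) : ℝ :=
  2 * zx x * qpi q (t1 * t2 * t3 * t4 / q ^ 3) *
    (qpi q (-t1 * zx x) * qpi q (t1 / zx x) * qpi q (-t2 * zx x) * qpi q (t2 / zx x) *
      qpi q (-t3 * zx x) * qpi q (t3 / zx x) * qpi q (-t4 * zx x) * qpi q (t4 / zx x)) /
  (qpi q q * qpi q (-(zx x) ^ 2) * qpi q (-q / (zx x) ^ 2) * Real.log (1 / q) *
    (qpi q (-t1 * t2 / q) * qpi q (-t1 * t3 / q) * qpi q (-t1 * t4 / q) *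
      qpi q (-t2 * t3 / q) * qpi q (-t2 * t4 / q) * qpi q (-t3 * t4 / q)))

/-- The mass points `x_n(α) = (q^{-n}/α - α q^n)/2` of the Ismail–Masson measure. -/
def xpt (q α : ℝ) (n : ℤ) : ℝ := (q ^ (-n) / α - α * q ^ n) / 2

/-- The masses `m_n(α)` of the Ismail–Masson measure `μ_α`. -/
def mass (q α : ℝ) (n : ℤ) : ℝ :=
  α ^ (4 * n) * q ^ (n * (2 * n - 1)) * (1 + α ^ 2 * q ^ (2 * n)) /
    (qpi q (-α ^ 2) * qpi q (-q / α ^ 2) * qpi q q)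

section QPochhammer

variable {q : ℝ}

lemma summable_norm_mul_pow (hq0 : 0 < q) (hq1 : q < 1) (a : ℝ) :
    Summable fun j : ℕ => ‖-(a * q ^ j)‖ := by
  simp only [norm_neg, norm_mul, norm_pow, Real.norm_of_nonneg hq0.le]
  exact (summable_geometric_of_lt_one hq0.le hq1).mul_left _

lemma multipliable_one_sub_mul_pow (hq0 : 0 < q) (hq1 : q < 1) (a : ℝ) :
    Multipliable fun j : ℕ => 1 - a * q ^ j := by
  simpa only [sub_eq_add_neg] using
    multipliable_one_add_of_summable (summable_norm_mul_pow hq0 hq1 a)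

lemma tendsto_qp (hq0 : 0 < q) (hq1 : q < 1) (a : ℝ) :
    Tendsto (qp q a) atTop (𝓝 (qpi q a)) :=
  (multipliable_one_sub_mul_pow hq0 hq1 a).hasProd.tendsto_prod_nat

lemma qpi_eq_mul (hq0 : 0 < q) (hq1 : q < 1) (a : ℝ) :
    qpi q a = (1 - a) * qpi q (a * q) := by
  have hstep : ∀ j : ℕ, a * q * q ^ j = a * q ^ (j + 1) := fun j => by ring
  have h := multipliable_one_sub_mul_pow hq0 hq1 (a * q)
  simp only [hstep] at h
  simp only [qpi, hstep]
  rw [tprod_eq_zero_mul' (f := fun j : ℕ => 1 - a * q ^ j) h, pow_zero, mul_one]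

lemma qpi_zero (q : ℝ) : qpi q 0 = 1 := by simp [qpi]

lemma qpi_eq_zero {a : ℝ} {j : ℕ} (h : a * q ^ j = 1) : qpi q a = 0 :=
  tprod_of_exists_eq_zero ⟨j, by simp [h]⟩

lemma abs_qpi_le (hq0 : 0 < q) (hq1 : q < 1) {a b : ℝ} (h : |a| ≤ b) :
    |qpi q a| ≤ qpi q (-b) := by
  refine le_of_tendsto_of_tendsto' (tendsto_qp hq0 hq1 a).abs (tendsto_qp hq0 hq1 (-b))
    fun N => ?_
  rw [qp, qp, Finset.abs_prod]
  refine Finset.prod_le_prod (fun _ _ => abs_nonneg _) fun j _ => ?_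
  have hj : 0 < q ^ j := pow_pos hq0 j
  calc |1 - a * q ^ j| ≤ |1| + |a * q ^ j| := abs_sub _ _
    _ = 1 + |a| * q ^ j := by rw [abs_one, abs_mul, abs_of_pos hj]
    _ ≤ 1 - -b * q ^ j := by nlinarith

lemma qpi_pos (hq0 : 0 < q) (hq1 : q < 1) {a : ℝ} (h : a < 1) : 0 < qpi q a := by
  have hpos : ∀ j : ℕ, 0 < 1 - a * q ^ j := fun j => by
    have h0 : 0 < q ^ j := pow_pos hq0 j
    have h1 : q ^ j ≤ 1 := pow_le_one₀ hq0.le hq1.le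
    rcases le_or_gt a 0 with ha | ha <;> nlinarith
  have hne : qpi q a ≠ 0 := by
    have := tprod_one_add_ne_zero_of_summable (f := fun j : ℕ => -(a * q ^ j))
      (fun j => by simpa only [sub_eq_add_neg] using (hpos j).ne')
      (summable_norm_mul_pow hq0 hq1 a)
    simpa only [qpi, sub_eq_add_neg] using this
  exact lt_of_le_of_ne (ge_of_tendsto' (tendsto_qp hq0 hq1 a) fun N =>
    Finset.prod_nonneg fun j _ => (hpos j).le) hne.symm

lemma abs_qpi_sub_one_le (hq0 : 0 < q) (hq1 : q < 1) (a : ℝ) :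
    |qpi q a - 1| ≤ Real.exp (|a| * (1 - q)⁻¹) - 1 := by
  refine le_of_tendsto' ((tendsto_qp hq0 hq1 a).sub_const 1).abs fun N => ?_
  have h := (Finset.range N).norm_prod_one_add_sub_one_le fun j : ℕ => -(a * q ^ j)
  simp only [← sub_eq_add_neg, Real.norm_eq_abs] at h
  refine h.trans (sub_le_sub_right (Real.exp_le_exp.2 ?_) 1)
  simp only [abs_neg, abs_mul, abs_pow, abs_of_pos hq0, ← Finset.mul_sum]
  gcongr
  rw [← tsum_geometric_of_lt_one hq0.le hq1]
  exact (summable_geometric_of_lt_one hq0.le hq1).sum_le_tsum _ fun j _ => by positivity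

lemma tendsto_qpi_one {ι : Type*} {l : Filter ι} (hq0 : 0 < q) (hq1 : q < 1) {f : ι → ℝ}
    (hf : Tendsto f l (𝓝 0)) : Tendsto (fun i => qpi q (f i)) l (𝓝 1) := by
  rw [tendsto_iff_norm_sub_tendsto_zero]
  refine squeeze_zero (fun _ => norm_nonneg _) (fun i => abs_qpi_sub_one_le hq0 hq1 (f i)) ?_
  have : Continuous fun x : ℝ => Real.exp (|x| * (1 - q)⁻¹) - 1 := by fun_prop
  simpa [Function.comp_def] using (this.tendsto 0).comp hf

end QPochhammer

/-- The kernel `(-qt/u, qtu;q)_∞`, where `u = 1/z`. -/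
def kernel (q t u : ℝ) : ℝ := qpi q (-q * t / u) * qpi q (q * t * u)

/-- The majorant `(-a/u, -au;q)_∞` of the kernels with parameter at most `a`. -/
def kernelBound (q a u : ℝ) : ℝ := qpi q (-(a / u)) * qpi q (-(a * u))

/-- The values `u = αqⁿ` of `1/z` at the mass points. -/
def invPoint (q α : ℝ) (n : ℤ) : ℝ := α * q ^ n

/-- The masses, up to normalization and the factor `1 + u²`. -/
def weight (q α : ℝ) (n : ℤ) : ℝ := α ^ (4 * n) * q ^ (n * (2 * n - 1))

/-- The unnormalized summand of the total mass. -/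
def massTerm (q α t1 t2 t3 : ℝ) (n : ℤ) : ℝ :=
  kernel q t1 (invPoint q α n) * kernel q t2 (invPoint q α n) * kernel q t3 (invPoint q α n) *
    (weight q α n * (1 + invPoint q α n ^ 2))

/-- The telescoping certificate for the `q`-difference equation of the total mass. -/
def massCert (q α t1 t2 t3 : ℝ) (n : ℤ) : ℝ :=
  ((1 - t1 * invPoint q α n) * kernel q t1 (invPoint q α n)) *
    ((1 - t2 * invPoint q α n) * kernel q t2 (invPoint q α n)) *
    ((1 - t3 * invPoint q α n) * kernel q t3 (invPoint q α n)) *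
    (weight q α n * (invPoint q α n)⁻¹)

section TotalMass

variable {q α : ℝ}

lemma kernel_zero (q u : ℝ) : kernel q 0 u = 1 := by simp [kernel, qpi_zero]

lemma invPoint_pos (hq0 : 0 < q) (hα : 0 < α) (n : ℤ) : 0 < invPoint q α n :=
  mul_pos hα (zpow_pos hq0 n)

lemma weight_pos (hq0 : 0 < q) (hα : 0 < α) (n : ℤ) : 0 < weight q α n :=
  mul_pos (zpow_pos hα _) (zpow_pos hq0 _)

lemma invPoint_succ (hq0 : 0 < q) (n : ℤ) : invPoint q α (n + 1) = invPoint q α n * q := by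
  rw [invPoint, invPoint, zpow_add_one₀ hq0.ne', mul_assoc]

lemma weight_succ (hq0 : 0 < q) (hα : 0 < α) (n : ℤ) :
    weight q α (n + 1) = q * invPoint q α n ^ 4 * weight q α n := by
  have h1 : α ^ (4 * (n + 1)) = α ^ (4 * n) * α ^ 4 := by
    rw [mul_add, zpow_add₀ hα.ne']; norm_cast
  have h2 : q ^ ((n + 1) * (2 * (n + 1) - 1)) = q ^ (n * (2 * n - 1)) * q * (q ^ n) ^ 4 := by
    rw [← zpow_natCast (q ^ n), ← zpow_mul, ← zpow_add_one₀ hq0.ne', ← zpow_add₀ hq0.ne']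
    congr 1; push_cast; ring
  rw [weight, weight, invPoint, h1, h2]; ring

lemma kernel_eq_mul (hq0 : 0 < q) (hq1 : q < 1) (t u : ℝ) :
    kernel q t u = (1 + q * t / u) * (1 - q * t * u) * kernel q (q * t) u := by
  rw [kernel, kernel, qpi_eq_mul hq0 hq1 (-q * t / u), qpi_eq_mul hq0 hq1 (q * t * u)]
  ring_nf

lemma kernel_mul_right (hq0 : 0 < q) (hq1 : q < 1) (t : ℝ) {u : ℝ} (hu : 0 < u) :
    (1 - t * (u * q)) * kernel q t (u * q) = (1 + t / u) * kernel q t u := by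
  have h1 : -q * t / (u * q) = -(t / u) := by field_simp
  have h2 := qpi_eq_mul hq0 hq1 (-(t / u))
  have h3 := qpi_eq_mul hq0 hq1 (q * t * u)
  have h4 : -(t / u) * q = -q * t / u := by ring
  have h5 : q * t * u * q = q * t * (u * q) := by ring
  rw [kernel, kernel, h1, h2, h3, h4, h5]
  ring

lemma one_sub_mul_kernel (hq0 : 0 < q) (hq1 : q < 1) (t u : ℝ) :
    (1 - t * u) * kernel q t u = qpi q (-q * t / u) * qpi q (t * u) := by
  rw [kernel, qpi_eq_mul hq0 hq1 (t * u)]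
  ring_nf

lemma kernelBound_pos (hq0 : 0 < q) (hq1 : q < 1) {a u : ℝ} (ha : 0 ≤ a) (hu : 0 < u) :
    0 < kernelBound q a u := by
  have h1 : 0 ≤ a / u := by positivity
  have h2 : 0 ≤ a * u := by positivity
  exact mul_pos (qpi_pos hq0 hq1 (by linarith)) (qpi_pos hq0 hq1 (by linarith))

lemma kernelBound_mul_right (hq0 : 0 < q) (hq1 : q < 1) (a : ℝ) {u : ℝ} (hu : 0 < u) :
    (1 + a * u) * kernelBound q a (u * q) = (1 + a / (u * q)) * kernelBound q a u := by
  have h1 := qpi_eq_mul hq0 hq1 (-(a / (u * q)))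
  have h2 := qpi_eq_mul hq0 hq1 (-(a * u))
  have h3 : -(a / (u * q)) * q = -(a / u) := by field_simp
  have h4 : -(a * u) * q = -(a * (u * q)) := by ring
  rw [kernelBound, kernelBound, h1, h2, h3, h4]
  ring

lemma abs_div_le_of_abs_le (hq0 : 0 < q) (hq1 : q < 1) {t a u : ℝ} (h : |t| ≤ a) (hu : 0 < u) :
    |(-q * t / u)| ≤ a / u := by
  rw [abs_div, abs_mul, abs_neg, abs_of_pos hq0, abs_of_pos hu]
  gcongr
  nlinarith [abs_nonneg t]

lemma abs_kernel_le (hq0 : 0 < q) (hq1 : q < 1) {t a u : ℝ} (h : |t| ≤ a) (hu : 0 < u) :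
    |kernel q t u| ≤ kernelBound q a u := by
  have h2 : |q * t * u| ≤ a * u := by
    rw [abs_mul, abs_mul, abs_of_pos hq0, abs_of_pos hu]
    gcongr
    nlinarith [abs_nonneg t]
  rw [kernel, kernelBound, abs_mul]
  exact mul_le_mul (abs_qpi_le hq0 hq1 (abs_div_le_of_abs_le hq0 hq1 h hu))
    (abs_qpi_le hq0 hq1 h2) (abs_nonneg _)
    ((abs_nonneg _).trans (abs_qpi_le hq0 hq1 (abs_div_le_of_abs_le hq0 hq1 h hu)))

lemma abs_one_sub_mul_kernel_le (hq0 : 0 < q) (hq1 : q < 1) {t a u : ℝ} (h : |t| ≤ a)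
    (hu : 0 < u) : |(1 - t * u) * kernel q t u| ≤ kernelBound q a u := by
  have h2 : |t * u| ≤ a * u := by
    rw [abs_mul, abs_of_pos hu]
    gcongr
  rw [one_sub_mul_kernel hq0 hq1, kernelBound, abs_mul]
  exact mul_le_mul (abs_qpi_le hq0 hq1 (abs_div_le_of_abs_le hq0 hq1 h hu))
    (abs_qpi_le hq0 hq1 h2) (abs_nonneg _)
    ((abs_nonneg _).trans (abs_qpi_le hq0 hq1 (abs_div_le_of_abs_le hq0 hq1 h hu)))

lemma abs_mul_three_le {x y z b : ℝ} (hx : |x| ≤ b) (hy : |y| ≤ b) (hz : |z| ≤ b) :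
    |x * y * z| ≤ b ^ 3 := by
  have hb : 0 ≤ b := (abs_nonneg x).trans hx
  rw [abs_mul, abs_mul, pow_three']
  gcongr

lemma tendsto_invPoint_natCast (hq0 : 0 < q) (hq1 : q < 1) :
    Tendsto (fun n : ℕ => invPoint q α n) atTop (𝓝 0) := by
  simpa [invPoint] using (tendsto_pow_atTop_nhds_zero_of_lt_one hq0.le hq1).const_mul α

lemma tendsto_inv_invPoint_neg (hq0 : 0 < q) (hq1 : q < 1) :
    Tendsto (fun n : ℕ => (invPoint q α (-((n + 1 : ℕ) : ℤ)))⁻¹) atTop (𝓝 0) := by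
  have h := ((tendsto_pow_atTop_nhds_zero_of_lt_one hq0.le hq1).comp
    (tendsto_add_atTop_nat 1)).const_mul α⁻¹
  rw [mul_zero] at h
  refine h.congr fun n => ?_
  rw [invPoint, zpow_neg, zpow_natCast, mul_inv, inv_inv]
  rfl

lemma summable_kernelBound (hq0 : 0 < q) (hq1 : q < 1) (hα : 0 < α) {a : ℝ} (ha : 0 ≤ a) (k : ℤ) :
    Summable fun n : ℤ =>
      kernelBound q a (invPoint q α n) ^ 3 * (weight q α n * invPoint q α n ^ k) := by
  set S : ℤ → ℝ := fun n =>
    kernelBound q a (invPoint q α n) ^ 3 * (weight q α n * invPoint q α n ^ k) with hS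
  have hpos : ∀ n, 0 < S n := fun n => by
    have hu := invPoint_pos hq0 hα n
    have := kernelBound_pos hq0 hq1 ha hu
    have := weight_pos hq0 hα n
    positivity
  have hratio : ∀ n, S (n + 1) / S n = q ^ (k + 1) *
      (invPoint q α n * (invPoint q α n + a / q) ^ 3 / (1 + a * invPoint q α n) ^ 3) := by
    intro n
    have hn := (hpos n).ne'
    simp only [hS] at hn ⊢
    rw [weight_succ hq0 hα, invPoint_succ hq0]
    have hu := invPoint_pos hq0 hα n
    have hB := kernelBound_pos hq0 hq1 ha hu
    have hw := weight_pos hq0 hα n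
    have hstep := kernelBound_mul_right hq0 hq1 a hu
    generalize invPoint q α n = u at *
    generalize weight q α n = w at *
    have h1 : 0 < 1 + a * u := by positivity
    have hB' : kernelBound q a (u * q) =
        (1 + a / (u * q)) * kernelBound q a u / (1 + a * u) := by
      rw [← hstep]; field_simp
    rw [hB', mul_zpow, zpow_add_one₀ hq0.ne']
    generalize kernelBound q a u = B at *
    field_simp
  refine Summable.of_nat_of_neg ?_ ?_
  · refine summable_of_ratio_test_tendsto_lt_one (l := 0) one_pos
      (.of_forall fun n => (hpos n).ne') ?_
    have hc : ContinuousAt (fun u : ℝ => q ^ (k + 1) * (u * (u + a / q) ^ 3 / (1 + a * u) ^ 3))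
        0 := by
      fun_prop (disch := simp)
    have h := hc.tendsto.comp (tendsto_invPoint_natCast (α := α) hq0 hq1)
    simp only [zero_mul, zero_div, mul_zero] at h
    refine h.congr fun n => ?_
    rw [Real.norm_of_nonneg (hpos _).le, Real.norm_of_nonneg (hpos _).le]
    push_cast
    rw [hratio]
    rfl
  · refine summable_of_ratio_test_tendsto_lt_one (l := 0) one_pos
      (.of_forall fun n => (hpos _).ne') ?_
    have hc : ContinuousAt
        (fun s : ℝ => (q ^ (k + 1))⁻¹ * (s * (s + a) ^ 3 / (1 + a / q * s) ^ 3)) 0 := by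
      fun_prop (disch := simp)
    have h := hc.tendsto.comp (tendsto_inv_invPoint_neg (α := α) hq0 hq1)
    simp only [zero_mul, zero_div, mul_zero] at h
    refine h.congr fun n => ?_
    rw [Real.norm_of_nonneg (hpos _).le, Real.norm_of_nonneg (hpos _).le]
    have hr := hratio (-((n + 1 : ℕ) : ℤ))
    have hn : (-((n + 1 : ℕ) : ℤ)) + 1 = -(n : ℤ) := by push_cast; ring
    rw [hn] at hr
    rw [← inv_div (S (-(n : ℤ))) (S (-((n + 1 : ℕ) : ℤ))), hr]
    have hu := invPoint_pos hq0 hα (-((n + 1 : ℕ) : ℤ))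
    simp only [Function.comp_apply]
    generalize invPoint q α (-((n + 1 : ℕ) : ℤ)) = u at *
    rw [mul_inv, inv_div]
    congr 1
    field_simp

lemma summable_massBound (hq0 : 0 < q) (hq1 : q < 1) (hα : 0 < α) {a : ℝ} (ha : 0 ≤ a) :
    Summable fun n : ℤ =>
      kernelBound q a (invPoint q α n) ^ 3 * (weight q α n * (1 + invPoint q α n ^ 2)) := by
  refine ((summable_kernelBound hq0 hq1 hα ha 0).add
    (summable_kernelBound hq0 hq1 hα ha 2)).congr fun n => ?_
  rw [zpow_zero]
  norm_cast
  ring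

lemma abs_massTerm_le (hq0 : 0 < q) (hq1 : q < 1) (hα : 0 < α) {t1 t2 t3 a : ℝ}
    (h1 : |t1| ≤ a) (h2 : |t2| ≤ a) (h3 : |t3| ≤ a) (n : ℤ) :
    |massTerm q α t1 t2 t3 n| ≤
      kernelBound q a (invPoint q α n) ^ 3 * (weight q α n * (1 + invPoint q α n ^ 2)) := by
  have hu := invPoint_pos hq0 hα n
  have hw : 0 < weight q α n * (1 + invPoint q α n ^ 2) :=
    mul_pos (weight_pos hq0 hα n) (by positivity)
  rw [massTerm, abs_mul, abs_of_pos hw]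
  gcongr
  exact abs_mul_three_le (abs_kernel_le hq0 hq1 h1 hu) (abs_kernel_le hq0 hq1 h2 hu)
    (abs_kernel_le hq0 hq1 h3 hu)

lemma exists_abs_le_three (t1 t2 t3 : ℝ) : ∃ a, 0 ≤ a ∧ |t1| ≤ a ∧ |t2| ≤ a ∧ |t3| ≤ a :=
  ⟨|t1| + |t2| + |t3|, by positivity, by linarith [abs_nonneg t2, abs_nonneg t3],
    by linarith [abs_nonneg t1, abs_nonneg t3], by linarith [abs_nonneg t1, abs_nonneg t2]⟩

lemma summable_massTerm (hq0 : 0 < q) (hq1 : q < 1) (hα : 0 < α) (t1 t2 t3 : ℝ) :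
    Summable (massTerm q α t1 t2 t3) := by
  obtain ⟨a, ha, h1, h2, h3⟩ := exists_abs_le_three t1 t2 t3
  exact (summable_massBound hq0 hq1 hα ha).of_norm_bounded
    (abs_massTerm_le hq0 hq1 hα h1 h2 h3)

lemma summable_massCert (hq0 : 0 < q) (hq1 : q < 1) (hα : 0 < α) (t1 t2 t3 : ℝ) :
    Summable (massCert q α t1 t2 t3) := by
  obtain ⟨a, ha, h1, h2, h3⟩ := exists_abs_le_three t1 t2 t3
  refine (summable_kernelBound hq0 hq1 hα ha (-1)).of_norm_bounded fun n => ?_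
  have hu := invPoint_pos hq0 hα n
  have hw : 0 < weight q α n * (invPoint q α n)⁻¹ :=
    mul_pos (weight_pos hq0 hα n) (by positivity)
  rw [massCert, Real.norm_eq_abs, abs_mul, abs_of_pos hw, zpow_neg_one]
  gcongr
  exact abs_mul_three_le (abs_one_sub_mul_kernel_le hq0 hq1 h1 hu)
    (abs_one_sub_mul_kernel_le hq0 hq1 h2 hu) (abs_one_sub_mul_kernel_le hq0 hq1 h3 hu)

lemma massTerm_sub (hq0 : 0 < q) (hq1 : q < 1) (hα : 0 < α) (t1 t2 t3 : ℝ) (n : ℤ) :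
    massTerm q α t1 t2 t3 n =
      (1 + q * t1 * t2) * (1 + q * t1 * t3) * massTerm q α (q * t1) t2 t3 n +
        q * t1 * (massCert q α (q * t1) t2 t3 n - massCert q α (q * t1) t2 t3 (n + 1)) := by
  have hu := invPoint_pos hq0 hα n
  rw [massCert, massCert, massTerm, massTerm, weight_succ hq0 hα, invPoint_succ hq0,
    kernel_mul_right hq0 hq1 _ hu, kernel_mul_right hq0 hq1 _ hu, kernel_mul_right hq0 hq1 _ hu,
    kernel_eq_mul hq0 hq1 t1]
  generalize invPoint q α n = u at *
  field_simp
  ring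

lemma tsum_massTerm_step (hq0 : 0 < q) (hq1 : q < 1) (hα : 0 < α) (t1 t2 t3 : ℝ) :
    ∑' n, massTerm q α t1 t2 t3 n =
      (1 + q * t1 * t2) * (1 + q * t1 * t3) * ∑' n, massTerm q α (q * t1) t2 t3 n := by
  have hc := summable_massCert hq0 hq1 hα (q * t1) t2 t3
  have hc' : Summable fun n => massCert q α (q * t1) t2 t3 (n + 1) :=
    (Equiv.addRight (1 : ℤ)).summable_iff.2 hc
  have hs : ∑' n, massCert q α (q * t1) t2 t3 (n + 1) = ∑' n, massCert q α (q * t1) t2 t3 n :=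
    (Equiv.addRight (1 : ℤ)).tsum_eq (massCert q α (q * t1) t2 t3)
  rw [tsum_congr (massTerm_sub hq0 hq1 hα t1 t2 t3),
    ((summable_massTerm hq0 hq1 hα (q * t1) t2 t3).mul_left _).tsum_add
      ((hc.sub hc').mul_left _), tsum_mul_left, tsum_mul_left, hc.tsum_sub hc', hs, sub_self,
    mul_zero, add_zero]

lemma tsum_massTerm_iterate (hq0 : 0 < q) (hq1 : q < 1) (hα : 0 < α) (t1 t2 t3 : ℝ) (N : ℕ) :
    ∑' n, massTerm q α t1 t2 t3 n =
      qp q (-q * t1 * t2) N * qp q (-q * t1 * t3) N *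
        ∑' n, massTerm q α (q ^ N * t1) t2 t3 n := by
  induction N with
  | zero => simp [qp]
  | succ N ih =>
    rw [ih, tsum_massTerm_step hq0 hq1 hα (q ^ N * t1), qp, qp, qp, qp, Finset.prod_range_succ,
      Finset.prod_range_succ, ← mul_assoc q, ← pow_succ']
    ring

lemma tendsto_tsum_massTerm (hq0 : 0 < q) (hq1 : q < 1) (hα : 0 < α) (t1 t2 t3 : ℝ) :
    Tendsto (fun N : ℕ => ∑' n, massTerm q α (q ^ N * t1) t2 t3 n) atTop
      (𝓝 (∑' n, massTerm q α 0 t2 t3 n)) := by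
  obtain ⟨a, ha, h1, h2, h3⟩ := exists_abs_le_three t1 t2 t3
  refine tendsto_tsum_of_dominated_convergence (summable_massBound hq0 hq1 hα ha)
    (fun n => ?_) (.of_forall fun N n => abs_massTerm_le hq0 hq1 hα ?_ h2 h3 n)
  · have ht : Tendsto (fun N : ℕ => q ^ N * t1) atTop (𝓝 0) := by
      simpa using (tendsto_pow_atTop_nhds_zero_of_lt_one hq0.le hq1).mul_const t1
    have hk : Tendsto (fun N : ℕ => kernel q (q ^ N * t1) (invPoint q α n)) atTop
        (𝓝 (kernel q 0 (invPoint q α n))) := by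
      rw [kernel_zero, ← one_mul (1 : ℝ)]
      refine (tendsto_qpi_one hq0 hq1 ?_).mul (tendsto_qpi_one hq0 hq1 ?_)
      · simpa using (ht.const_mul (-q)).div_const (invPoint q α n)
      · simpa using (ht.const_mul q).mul_const (invPoint q α n)
    exact ((hk.mul_const _).mul_const _).mul_const _
  · rw [abs_mul, abs_of_pos (pow_pos hq0 N)]
    exact (mul_le_of_le_one_left (abs_nonneg _) (pow_le_one₀ hq0.le hq1.le)).trans h1

lemma tsum_massTerm_eq_mul_zero (hq0 : 0 < q) (hq1 : q < 1) (hα : 0 < α) (t1 t2 t3 : ℝ) :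
    ∑' n, massTerm q α t1 t2 t3 n =
      qpi q (-q * t1 * t2) * qpi q (-q * t1 * t3) * ∑' n, massTerm q α 0 t2 t3 n := by
  refine tendsto_nhds_unique (tendsto_const_nhds (f := atTop (α := ℕ))) ?_
  exact (((tendsto_qp hq0 hq1 _).mul (tendsto_qp hq0 hq1 _)).mul
    (tendsto_tsum_massTerm hq0 hq1 hα t1 t2 t3)).congr fun N =>
      (tsum_massTerm_iterate hq0 hq1 hα t1 t2 t3 N).symm

lemma massTerm_swap (q α t1 t2 t3 : ℝ) : massTerm q α t1 t2 t3 = massTerm q α t2 t1 t3 := by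
  ext n
  rw [massTerm, massTerm, mul_comm (kernel q t1 _)]

lemma massTerm_rotate (q α t1 t2 t3 : ℝ) : massTerm q α t1 t2 t3 = massTerm q α t3 t1 t2 := by
  ext n
  rw [massTerm, massTerm]
  ring

lemma tsum_massTerm_eq_mul (hq0 : 0 < q) (hq1 : q < 1) (hα : 0 < α) (t1 t2 t3 : ℝ) :
    ∑' n, massTerm q α t1 t2 t3 n =
      qpi q (-q * t1 * t2) * qpi q (-q * t1 * t3) * qpi q (-q * t2 * t3) *
        ∑' n, massTerm q α 0 0 0 n := by
  rw [tsum_massTerm_eq_mul_zero hq0 hq1 hα, massTerm_swap, tsum_massTerm_eq_mul_zero hq0 hq1 hα,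
    massTerm_rotate, tsum_massTerm_eq_mul_zero hq0 hq1 hα]
  simp only [mul_zero, qpi_zero, one_mul, mul_assoc]

/-- At `t₁ = 1/α`, `t₂ = -α`, `t₃ = 0` only the term `n = 0` survives. -/
lemma tsum_massTerm_special (hq0 : 0 < q) (hα : 0 < α) :
    ∑' n, massTerm q α α⁻¹ (-α) 0 n = massTerm q α α⁻¹ (-α) 0 0 := by
  refine tsum_eq_single 0 fun n hn => ?_
  rcases lt_or_gt_of_ne hn with h | h
  · obtain ⟨m, rfl⟩ : ∃ m : ℕ, n = -((m : ℤ) + 1) := ⟨(-n - 1).toNat, by omega⟩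
    have hz : qpi q (q * α⁻¹ * invPoint q α (-((m : ℤ) + 1))) = 0 := by
      refine qpi_eq_zero (j := m) ?_
      rw [invPoint, zpow_neg, zpow_add_one₀ hq0.ne', zpow_natCast]
      field_simp
    simp only [massTerm, kernel, hz, mul_zero, zero_mul]
  · obtain ⟨m, rfl⟩ : ∃ m : ℕ, n = (m : ℤ) + 1 := ⟨(n - 1).toNat, by omega⟩
    have hz : qpi q (-q * -α / invPoint q α ((m : ℤ) + 1)) = 0 := by
      refine qpi_eq_zero (j := m) ?_
      rw [invPoint, zpow_add_one₀ hq0.ne', zpow_natCast]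
      field_simp
    simp only [massTerm, kernel, hz, mul_zero, zero_mul]

/-- The normalization of the masses, a form of the Jacobi triple product. -/
lemma tsum_massTerm_zero (hq0 : 0 < q) (hq1 : q < 1) (hα : 0 < α) :
    ∑' n, massTerm q α 0 0 0 n = qpi q (-α ^ 2) * qpi q (-q / α ^ 2) * qpi q q := by
  have h := tsum_massTerm_eq_mul hq0 hq1 hα α⁻¹ (-α) 0
  rw [tsum_massTerm_special hq0 hα] at h
  have e1 : -q * α⁻¹ * -α = q := by field_simp
  have e2 : -q * α⁻¹ / α = -q / α ^ 2 := by field_simp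
  have e3 : q * α⁻¹ * α = q := by field_simp
  have e4 : -q * -α / α = q := by field_simp
  have e5 : q * -α * α = -α ^ 2 * q := by ring
  have hl : massTerm q α α⁻¹ (-α) 0 0 =
      qpi q (-q / α ^ 2) * qpi q q * (qpi q q * qpi q (-α ^ 2 * q)) * (1 + α ^ 2) := by
    simp only [massTerm, kernel, weight, invPoint, zpow_zero, mul_zero, zero_mul, zero_div, qpi_zero,
      mul_one, one_mul, e2, e3, e4, e5]
  simp only [hl, mul_zero, mul_one, qpi_zero, e1] at h
  rw [qpi_eq_mul hq0 hq1 (-α ^ 2)]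
  refine mul_left_cancel₀ (qpi_pos hq0 hq1 hq1).ne' (h.symm.trans ?_)
  ring

end TotalMass

theorem total_mass_lemma
    (q : ℝ) (hq0 : 0 < q) (hq1 : q < 1) (t1 t2 t3 : ℝ)
    (ht1 : 0 < t1) (ht2 : 0 < t2) (ht3 : 0 < t3)
    (α : ℝ) (hα1 : q < α) (hα2 : α < 1) :
    HasSum
      (fun n : ℤ =>
        qpi q (-q * t1 * (q ^ (-n) / α)) * qpi q (q * t1 * α * q ^ n) *
          qpi q (-q * t2 * (q ^ (-n) / α)) * qpi q (q * t2 * α * q ^ n) *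
          qpi q (-q * t3 * (q ^ (-n) / α)) * qpi q (q * t3 * α * q ^ n) *
          mass q α n)
      (qpi q (-q * t1 * t2) * qpi q (-q * t1 * t3) * qpi q (-q * t2 * t3)) := by
  have hα : 0 < α := hq0.trans hα1
  have hC : qpi q (-α ^ 2) * qpi q (-q / α ^ 2) * qpi q q ≠ 0 := by
    have h1 : -α ^ 2 < 1 := by nlinarith
    have h2 : -q / α ^ 2 < 1 := by rw [div_lt_one (by positivity)]; nlinarith
    exact (mul_pos (mul_pos (qpi_pos hq0 hq1 h1) (qpi_pos hq0 hq1 h2)) (qpi_pos hq0 hq1 hq1)).ne'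
  have h := (summable_massTerm hq0 hq1 hα t1 t2 t3).hasSum.div_const
    (qpi q (-α ^ 2) * qpi q (-q / α ^ 2) * qpi q q)
  rw [tsum_massTerm_eq_mul hq0 hq1 hα, tsum_massTerm_zero hq0 hq1 hα,
    mul_div_cancel_right₀ _ hC] at h
  refine h.congr_fun fun n => ?_
  have e1 : ∀ t, -q * t * (q ^ (-n) / α) = -q * t / invPoint q α n := fun t => by
    rw [invPoint, zpow_neg]; field_simp
  have e2 : ∀ t, q * t * α * q ^ n = q * t * invPoint q α n := fun t => by
    rw [invPoint]; ring
  have e3 : α ^ 2 * q ^ (2 * n) = invPoint q α n ^ 2 := by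
    rw [invPoint, mul_pow, mul_comm 2 n, zpow_mul]; norm_cast
  simp only [e1, e2, e3, mass, massTerm, kernel, weight]
  ring
end
end

section
/- Let t₁, t₂, t₃ be nonzero real numbers (with all q-shifted factorials appearing below nonzero). The polynomials V_n satisfy, for all n ∈ ℕ and all x ∈ ℝ (with V_{−1} := 0 and V_0 = 1), the three-term recurrence 2x V_n(x;t|q) = a_n V_{n+1}(x;t|q) + b_n V_n(x;t|q) + c_n V_{n−1}(x;t|q), where a_n = −(t₂t₃/q^{2n+2})(1 + q^{n+2}/(t₁t₂))(1 + q^{n+2}/(t₂t₃)), b_n = (t₁ + t₂ + t₃)/q^{n+1} + (t₁t₂t₃/q^{2n+3})(1 + q − q^{n+1}), and c_n = −(t₁²t₂t₃/q^{2n+3})(1 − q^n)(1 + q^{n+1}/(t₁t₃)). -/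
noncomputable section

open scoped BigOperators
open Finset MeasureTheory Filter Topology

/-- The polynomial `V_n(x; t₁,t₂,t₃ | q)`. -/
def Vp (q t1 t2 t3 : ℝ) (n : ℕ) (x : ℝ) : ℝ :=
  (t1 / q) ^ n * (qp q (-q ^ 2 / (t1 * t3)) n / qp q (-q ^ 2 / (t2 * t3)) n) *
  ∑ k ∈ Finset.range (n + 1),
    qp q (q ^ (-(n : ℤ))) k * qp q (-q / (t1 * zx x)) k * qp q (q * zx x / t1) k /
      (qp q q k * qp q (-q ^ 2 / (t1 * t3)) k * qp q (-q ^ 2 / (t1 * t2)) k) *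
      (-q ^ (n + 2) / (t2 * t3)) ^ k

theorem qp_zero (q a : ℝ) : qp q a 0 = 1 := by simp [qp]

theorem qp_succ (q a : ℝ) (k : ℕ) : qp q a (k + 1) = qp q a k * (1 - a * q ^ k) := by
  simp [qp, Finset.prod_range_succ]

theorem qp_succ_left (q a : ℝ) (k : ℕ) : qp q a (k + 1) = (1 - a) * qp q (a * q) k := by
  simp only [qp, Finset.prod_range_succ', pow_zero, mul_one]
  rw [mul_comm]
  congr 1
  exact Finset.prod_congr rfl fun j _ => by ring

theorem qp_self_ne_zero {q : ℝ} (hq0 : 0 < q) (hq1 : q < 1) (k : ℕ) : qp q q k ≠ 0 := by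
  refine Finset.prod_ne_zero_iff.2 fun j _ => ?_
  have h : q ^ (j + 1) < 1 := pow_lt_one₀ hq0.le hq1 (by simp)
  rw [pow_succ'] at h
  linarith

theorem one_sub_mul_pow_ne_zero {q a : ℝ} (h : ∀ k, qp q a k ≠ 0) (k : ℕ) :
    1 - a * q ^ k ≠ 0 := by
  have := h (k + 1)
  rw [qp_succ] at this
  exact right_ne_zero_of_mul this

theorem qp_zpow_neg_self_succ {q : ℝ} (hq : q ≠ 0) (n : ℕ) :
    qp q (q ^ (-(n : ℤ))) (n + 1) = 0 := by
  rw [qp_succ, zpow_neg, zpow_natCast, inv_mul_cancel₀ (pow_ne_zero n hq)]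
  simp

/-- The `k`-th basis polynomial `(-q/(t₁z), qz/t₁; q)_k`. -/
def basisV (q t1 x : ℝ) (k : ℕ) : ℝ :=
  qp q (-q / (t1 * zx x)) k * qp q (q * zx x / t1) k

/-- The coefficient of `basisV q t1 x k` in the sum defining `Vp`. -/
def coeffV (q t1 t2 t3 : ℝ) (n k : ℕ) : ℝ :=
  qp q (q ^ (-(n : ℤ))) k /
    (qp q q k * qp q (-q ^ 2 / (t1 * t3)) k * qp q (-q ^ 2 / (t1 * t2)) k) *
    (-q ^ (n + 2) / (t2 * t3)) ^ k

/-- The factor in front of the sum defining `Vp`. -/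
def prefactorV (q t1 t2 t3 : ℝ) (n : ℕ) : ℝ :=
  (t1 / q) ^ n * (qp q (-q ^ 2 / (t1 * t3)) n / qp q (-q ^ 2 / (t2 * t3)) n)

theorem Vp_eq (q t1 t2 t3 : ℝ) (n : ℕ) (x : ℝ) :
    Vp q t1 t2 t3 n x = prefactorV q t1 t2 t3 n *
      ∑ k ∈ Finset.range (n + 1), coeffV q t1 t2 t3 n k * basisV q t1 x k := by
  unfold Vp prefactorV coeffV basisV
  congr 1
  exact Finset.sum_congr rfl fun k _ => by ring

theorem coeffV_self_succ {q : ℝ} (hq : q ≠ 0) (t1 t2 t3 : ℝ) (n : ℕ) :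
    coeffV q t1 t2 t3 n (n + 1) = 0 := by
  rw [coeffV, qp_zpow_neg_self_succ hq, zero_div, zero_mul]

theorem coeffV_self_add_two {q : ℝ} (hq : q ≠ 0) (t1 t2 t3 : ℝ) (n : ℕ) :
    coeffV q t1 t2 t3 n (n + 2) = 0 := by
  rw [coeffV, qp_succ, qp_zpow_neg_self_succ hq, zero_mul, zero_div, zero_mul]

theorem zx_pos (x : ℝ) : 0 < zx x := by
  have h : |x| < Real.sqrt (x ^ 2 + 1) := by
    rw [← Real.sqrt_sq_eq_abs]
    exact Real.sqrt_lt_sqrt (sq_nonneg x) (by linarith)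
  have := neg_abs_le x
  unfold zx
  linarith

theorem two_mul_mul_zx (x : ℝ) : 2 * x * zx x = zx x ^ 2 - 1 := by
  have h : Real.sqrt (x ^ 2 + 1) ^ 2 = x ^ 2 + 1 := Real.sq_sqrt (by positivity)
  unfold zx
  linear_combination -h

theorem two_mul_mul_basisV {q t1 : ℝ} (hq : q ≠ 0) (ht1 : t1 ≠ 0) (x : ℝ) (k : ℕ) :
    2 * x * basisV q t1 x k =
      (t1 / q ^ (k + 1) - q ^ (k + 1) / t1) * basisV q t1 x k -
        t1 / q ^ (k + 1) * basisV q t1 x (k + 1) := by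
  have hz := (zx_pos x).ne'
  have hx : 2 * x = zx x - 1 / zx x := by
    field_simp
    linear_combination two_mul_mul_zx x
  rw [hx]
  simp only [basisV, qp_succ]
  field_simp
  ring

theorem coeffV_recurrence_zero {q t1 t2 t3 : ℝ} (hq : q ≠ 0)
    (ht1 : t1 ≠ 0) (ht2 : t2 ≠ 0) (ht3 : t3 ≠ 0) (n : ℕ) :
    t1 / q - q / t1 =
      -(t1 * t2 * t3 / q ^ (2 * n + 3)) * (1 + q ^ (n + 2) / (t1 * t2)) *
          (1 + q ^ (n + 2) / (t1 * t3)) +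
        ((t1 + t2 + t3) / q ^ (n + 1) +
          t1 * t2 * t3 / q ^ (2 * n + 3) * (1 + q - q ^ (n + 1))) -
        t1 * t2 * t3 / q ^ (2 * n + 2) * (1 - q ^ n) * (1 + q ^ (n + 1) / (t2 * t3)) := by
  have hQ := pow_ne_zero n hq
  simp only [pow_add, pow_mul']
  field_simp
  ring

theorem qp_zpow_neg_succ_succ {q : ℝ} (hq : q ≠ 0) (n k : ℕ) :
    qp q (q ^ (-((n + 1 : ℕ) : ℤ))) (k + 1) =
      (1 - (q ^ (n + 1))⁻¹) * qp q (q ^ (-(n : ℤ))) k := by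
  rw [qp_succ_left]
  have h : q ^ (-((n + 1 : ℕ) : ℤ)) * q = q ^ (-(n : ℤ)) := by
    rw [← zpow_add_one₀ hq]
    congr 1
    push_cast
    ring
  rw [h, zpow_neg, zpow_natCast]

theorem one_sub_mul_qp_zpow_neg_pred {q : ℝ} (hq : q ≠ 0) (n k : ℕ) :
    (1 - q ^ n) * qp q (q ^ (-((n - 1 : ℕ) : ℤ))) (k + 1) =
      -q ^ n * qp q (q ^ (-(n : ℤ))) k * (1 - (q ^ n)⁻¹ * q ^ k) *
        (1 - (q ^ n)⁻¹ * q ^ (k + 1)) := by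
  have hn : (q ^ n) ≠ 0 := pow_ne_zero n hq
  have h2 : qp q (q ^ (-(n : ℤ))) (k + 2) = qp q (q ^ (-(n : ℤ))) k *
      (1 - (q ^ n)⁻¹ * q ^ k) * (1 - (q ^ n)⁻¹ * q ^ (k + 1)) := by
    rw [qp_succ, qp_succ, zpow_neg, zpow_natCast]
  rw [mul_assoc (-q ^ n), mul_assoc (-q ^ n), ← h2]
  cases n with
  | zero => simp [qp_succ_left _ _ (k + 1)]
  | succ m =>
    rw [qp_zpow_neg_succ_succ hq, Nat.add_sub_cancel]
    field_simp
    ring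

theorem coeffV_recurrence_succ {q t1 t2 t3 : ℝ} (hq0 : 0 < q) (hq1 : q < 1)
    (ht1 : t1 ≠ 0) (ht2 : t2 ≠ 0) (ht3 : t3 ≠ 0)
    (hA : ∀ k, qp q (-q ^ 2 / (t1 * t3)) k ≠ 0) (hB : ∀ k, qp q (-q ^ 2 / (t1 * t2)) k ≠ 0)
    (n k : ℕ) :
    (t1 / q ^ (k + 2) - q ^ (k + 2) / t1) * coeffV q t1 t2 t3 n (k + 1) -
        t1 / q ^ (k + 1) * coeffV q t1 t2 t3 n k =
      -(t1 * t2 * t3 / q ^ (2 * n + 3)) * (1 + q ^ (n + 2) / (t1 * t2)) *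
          (1 + q ^ (n + 2) / (t1 * t3)) * coeffV q t1 t2 t3 (n + 1) (k + 1) +
        ((t1 + t2 + t3) / q ^ (n + 1) +
          t1 * t2 * t3 / q ^ (2 * n + 3) * (1 + q - q ^ (n + 1))) *
            coeffV q t1 t2 t3 n (k + 1) -
        t1 * t2 * t3 / q ^ (2 * n + 2) * (1 - q ^ n) * (1 + q ^ (n + 1) / (t2 * t3)) *
          coeffV q t1 t2 t3 (n - 1) (k + 1) := by
  have hq := hq0.ne'
  have hc := one_sub_mul_qp_zpow_neg_pred hq n k
  have hp : (1 - q ^ n) * coeffV q t1 t2 t3 (n - 1) (k + 1) =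
      -q ^ n * qp q (q ^ (-(n : ℤ))) k * (1 - (q ^ n)⁻¹ * q ^ k) *
        (1 - (q ^ n)⁻¹ * q ^ (k + 1)) /
      (qp q q (k + 1) * qp q (-q ^ 2 / (t1 * t3)) (k + 1) *
        qp q (-q ^ 2 / (t1 * t2)) (k + 1)) *
      ((-q ^ (n + 2) / (t2 * t3)) ^ (k + 1) / q ^ (k + 1)) := by
    rw [← hc]
    cases n with
    | zero => simp
    | succ m =>
      rw [← div_pow, coeffV, Nat.add_sub_cancel]
      have : -q ^ (m + 1 + 2) / (t2 * t3) / q = -q ^ (m + 2) / (t2 * t3) := by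
        field_simp
        ring
      rw [this]
      ring
  have hs : (-q ^ (n + 1 + 2) / (t2 * t3)) ^ (k + 1) =
      (-q ^ (n + 2) / (t2 * t3)) ^ (k + 1) * q ^ (k + 1) := by
    rw [← mul_pow]
    congr 1
    ring
  have hu : q ^ (-(n : ℤ)) = (q ^ n)⁻¹ := by rw [zpow_neg, zpow_natCast]
  rw [mul_right_comm _ (1 - q ^ n), mul_assoc _ (1 - q ^ n), hp]
  simp only [coeffV, qp_zpow_neg_succ_succ hq, hs, qp_succ]
  have h1 := qp_self_ne_zero hq0 hq1 k
  have h2 := one_sub_mul_pow_ne_zero (qp_self_ne_zero hq0 hq1) k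
  have h3 := one_sub_mul_pow_ne_zero hA k
  have h4 := one_sub_mul_pow_ne_zero hB k
  have h5 := hA k
  have h6 := hB k
  rw [hu, pow_succ (-q ^ (n + 2) / (t2 * t3)) k]
  generalize (-q ^ (n + 2) / (t2 * t3)) ^ k = y
  generalize qp q (q ^ n)⁻¹ k = P
  generalize qp q q k = R1 at *
  generalize qp q (-q ^ 2 / (t1 * t3)) k = R2 at *
  generalize qp q (-q ^ 2 / (t1 * t2)) k = R3 at *
  have hQ := pow_ne_zero n hq
  have hK := pow_ne_zero k hq
  simp only [pow_add, pow_mul'] at *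
  generalize q ^ n = Q at *
  generalize q ^ k = K at *
  have h3' : t1 * t3 + K * q ^ 2 ≠ 0 := by
    contrapose! h3
    field_simp
    linear_combination h3
  have h4' : t1 * t2 + K * q ^ 2 ≠ 0 := by
    contrapose! h4
    field_simp
    linear_combination h4
  have e3 : 1 - -q ^ 2 / (t1 * t3) * K = (t1 * t3 + K * q ^ 2) / (t1 * t3) := by
    field_simp
    ring
  have e4 : 1 - -q ^ 2 / (t1 * t2) * K = (t1 * t2 + K * q ^ 2) / (t1 * t2) := by
    field_simp
    ring
  have h2' : 1 - K * q ≠ 0 := by rwa [mul_comm]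
  rw [e3, e4]
  field_simp
  ring

theorem prefactorV_succ {q t1 t2 t3 : ℝ}
    (hC : ∀ k, qp q (-q ^ 2 / (t2 * t3)) k ≠ 0) (n : ℕ) :
    (1 + q ^ (n + 2) / (t2 * t3)) * prefactorV q t1 t2 t3 (n + 1) =
      t1 / q * (1 + q ^ (n + 2) / (t1 * t3)) * prefactorV q t1 t2 t3 n := by
  have h1 := hC n
  have h2 := one_sub_mul_pow_ne_zero hC n
  have e1 : 1 + q ^ (n + 2) / (t2 * t3) = 1 - -q ^ 2 / (t2 * t3) * q ^ n := by ring
  have e2 : 1 + q ^ (n + 2) / (t1 * t3) = 1 - -q ^ 2 / (t1 * t3) * q ^ n := by ring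
  rw [e1, e2]
  simp only [prefactorV, qp_succ, pow_succ (t1 / q) n]
  generalize 1 - -q ^ 2 / (t2 * t3) * q ^ n = X at *
  generalize 1 - -q ^ 2 / (t1 * t3) * q ^ n = Y at *
  generalize qp q (-q ^ 2 / (t2 * t3)) n = Z at *
  generalize qp q (-q ^ 2 / (t1 * t3)) n = W at *
  generalize (t1 / q) ^ n = T
  generalize t1 / q = S
  field_simp

theorem sum_coeffV_recurrence {q t1 t2 t3 : ℝ} (hq0 : 0 < q) (hq1 : q < 1)
    (ht1 : t1 ≠ 0) (ht2 : t2 ≠ 0) (ht3 : t3 ≠ 0)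
    (hA : ∀ k, qp q (-q ^ 2 / (t1 * t3)) k ≠ 0) (hB : ∀ k, qp q (-q ^ 2 / (t1 * t2)) k ≠ 0)
    (n : ℕ) (x : ℝ) :
    2 * x * ∑ k ∈ Finset.range (n + 1), coeffV q t1 t2 t3 n k * basisV q t1 x k =
      -(t1 * t2 * t3 / q ^ (2 * n + 3)) * (1 + q ^ (n + 2) / (t1 * t2)) *
          (1 + q ^ (n + 2) / (t1 * t3)) *
          ∑ k ∈ Finset.range (n + 2), coeffV q t1 t2 t3 (n + 1) k * basisV q t1 x k +
        ((t1 + t2 + t3) / q ^ (n + 1) +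
          t1 * t2 * t3 / q ^ (2 * n + 3) * (1 + q - q ^ (n + 1))) *
          ∑ k ∈ Finset.range (n + 2), coeffV q t1 t2 t3 n k * basisV q t1 x k -
        t1 * t2 * t3 / q ^ (2 * n + 2) * (1 - q ^ n) * (1 + q ^ (n + 1) / (t2 * t3)) *
          ∑ k ∈ Finset.range (n + 2), coeffV q t1 t2 t3 (n - 1) k * basisV q t1 x k := by
  have hq := hq0.ne'
  have h0 : ∀ m, coeffV q t1 t2 t3 m 0 = 1 := fun m => by simp [coeffV, qp_zero]
  have hsum : 2 * x * ∑ k ∈ Finset.range (n + 1), coeffV q t1 t2 t3 n k * basisV q t1 x k =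
      ∑ k ∈ Finset.range (n + 1),
        ((t1 / q ^ (k + 2) - q ^ (k + 2) / t1) * coeffV q t1 t2 t3 n (k + 1) -
          t1 / q ^ (k + 1) * coeffV q t1 t2 t3 n k) * basisV q t1 x (k + 1) +
        (t1 / q - q / t1) * basisV q t1 x 0 := by
    have hshift : ∑ k ∈ Finset.range (n + 1),
          (t1 / q ^ (k + 1) - q ^ (k + 1) / t1) * coeffV q t1 t2 t3 n k * basisV q t1 x k =
        ∑ k ∈ Finset.range (n + 1),
          (t1 / q ^ (k + 2) - q ^ (k + 2) / t1) * coeffV q t1 t2 t3 n (k + 1) *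
            basisV q t1 x (k + 1) + (t1 / q - q / t1) * basisV q t1 x 0 := by
      have := Finset.sum_range_succ (fun k =>
        (t1 / q ^ (k + 1) - q ^ (k + 1) / t1) * coeffV q t1 t2 t3 n k * basisV q t1 x k) (n + 1)
      rw [Finset.sum_range_succ', coeffV_self_succ hq, h0] at this
      simpa using this.symm
    simp only [sub_mul _ _ (basisV q t1 x _), Finset.sum_sub_distrib]
    simp only [← sub_mul]
    rw [sub_add_eq_add_sub, ← hshift, ← Finset.sum_sub_distrib, Finset.mul_sum]
    refine Finset.sum_congr rfl fun k _ => ?_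
    linear_combination coeffV q t1 t2 t3 n k * two_mul_mul_basisV hq ht1 x k
  rw [hsum]
  simp only [Finset.sum_range_succ' _ (n + 1), h0, coeffV_recurrence_zero hq ht1 ht2 ht3 n,
    coeffV_recurrence_succ hq0 hq1 ht1 ht2 ht3 hA hB n, sub_mul _ _ (basisV q t1 x _),
    add_mul _ _ (basisV q t1 x _), mul_add, Finset.sum_sub_distrib, Finset.sum_add_distrib,
    mul_assoc _ _ (basisV q t1 x _), ← Finset.mul_sum]
  ring

theorem three_term_recurrence_V
    (q : ℝ) (hq0 : 0 < q) (hq1 : q < 1) (t1 t2 t3 : ℝ)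
    (ht1 : t1 ≠ 0) (ht2 : t2 ≠ 0) (ht3 : t3 ≠ 0)
    (hne : ∀ k : ℕ,
      qp q (-q ^ 2 / (t1 * t2)) k ≠ 0 ∧ qp q (-q ^ 2 / (t1 * t3)) k ≠ 0 ∧
      qp q (-q ^ 2 / (t2 * t3)) k ≠ 0) :
    ∀ n : ℕ, ∀ x : ℝ,
      2 * x * Vp q t1 t2 t3 n x =
        (-(t2 * t3 / q ^ (2 * n + 2)) * (1 + q ^ (n + 2) / (t1 * t2)) *
            (1 + q ^ (n + 2) / (t2 * t3))) *
          Vp q t1 t2 t3 (n + 1) x +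
        ((t1 + t2 + t3) / q ^ (n + 1) +
            t1 * t2 * t3 / q ^ (2 * n + 3) * (1 + q - q ^ (n + 1))) *
          Vp q t1 t2 t3 n x +
        (-(t1 ^ 2 * t2 * t3 / q ^ (2 * n + 3)) * (1 - q ^ n) *
            (1 + q ^ (n + 1) / (t1 * t3))) *
          (if n = 0 then 0 else Vp q t1 t2 t3 (n - 1) x) := by
  intro n x
  have hq := hq0.ne'
  have hB := fun k => (hne k).1
  have hA := fun k => (hne k).2.1
  have hC := fun k => (hne k).2.2
  have hrec := sum_coeffV_recurrence hq0 hq1 ht1 ht2 ht3 hA hB n x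
  have hp := prefactorV_succ (t1 := t1) hC n
  rw [Finset.sum_range_succ (fun k => coeffV q t1 t2 t3 n k * basisV q t1 x k) (n + 1),
    coeffV_self_succ hq, zero_mul, add_zero] at hrec
  simp only [Vp_eq]
  cases n with
  | zero =>
    simp only [if_true]
    linear_combination prefactorV q t1 t2 t3 0 * hrec + t2 * t3 / q ^ (2 * 0 + 2) *
      (1 + q ^ (0 + 2) / (t1 * t2)) * hp *
      ∑ k ∈ Finset.range (0 + 2), coeffV q t1 t2 t3 (0 + 1) k * basisV q t1 x k
  | succ m =>
    have hp' := prefactorV_succ (t1 := t1) hC m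
    rw [Nat.add_sub_cancel,
      Finset.sum_range_succ (fun k => coeffV q t1 t2 t3 m k * basisV q t1 x k) (m + 2),
      Finset.sum_range_succ (fun k => coeffV q t1 t2 t3 m k * basisV q t1 x k) (m + 1),
      coeffV_self_succ hq, coeffV_self_add_two hq, zero_mul, zero_mul, add_zero,
      add_zero] at hrec
    rw [if_neg m.succ_ne_zero, Nat.add_sub_cancel]
    linear_combination prefactorV q t1 t2 t3 (m + 1) * hrec + t2 * t3 / q ^ (2 * (m + 1) + 2) *
      (1 + q ^ (m + 1 + 2) / (t1 * t2)) * hp *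
      ∑ k ∈ Finset.range (m + 1 + 2), coeffV q t1 t2 t3 (m + 1 + 1) k * basisV q t1 x k -
      t1 * t2 * t3 / q ^ (2 * (m + 1) + 2) * (1 - q ^ (m + 1)) * hp' *
      ∑ k ∈ Finset.range (m + 1), coeffV q t1 t2 t3 m k * basisV q t1 x k
end
end

section
/- Let t₁, t₂, t₃ be nonzero complex numbers and z a fixed nonzero complex number (with all q-shifted factorials appearing below nonzero), and let V̆_n(z) denote the defining formula for V_n as a function of z. Then lim_{n→∞} q^n t₁^{−n} V̆_n(z) = [(−q²/(t₁t₃);q)_∞ / (−q²/(t₂t₃);q)_∞] · Σ_{k=0}^{∞} [(−q/(t₁z);q)_k (qz/t₁;q)_k / ((q;q)_k (−q²/(t₁t₃);q)_k (−q²/(t₁t₂);q)_k)] q^{k(k−1)/2} (q²/(t₂t₃))^k, the series on the right converging absolutely (it is the nonterminating ₂φ₂ series ₂φ₂(−q/(t₁z), qz/t₁; −q²/(t₁t₃), −q²/(t₁t₂); q, −q²/(t₂t₃))). -/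
noncomputable section

open scoped BigOperators
open Finset MeasureTheory Filter Topology

/-- The finite q-shifted factorial `(a;q)_n` with complex argument. -/
def qpC (q : ℝ) (a : ℂ) (n : ℕ) : ℂ := ∏ j ∈ Finset.range n, (1 - a * (q : ℂ) ^ j)

/-- The infinite q-shifted factorial `(a;q)_∞` with complex argument. -/
def qpiC (q : ℝ) (a : ℂ) : ℂ := ∏' j : ℕ, (1 - a * (q : ℂ) ^ j)

/-- The polynomial `V_n` as a function of `z` with complex parameters. -/
def VzC (q : ℝ) (t1 t2 t3 : ℂ) (n : ℕ) (z : ℂ) : ℂ :=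
  (t1 / (q : ℂ)) ^ n *
    (qpC q (-(q : ℂ) ^ 2 / (t1 * t3)) n / qpC q (-(q : ℂ) ^ 2 / (t2 * t3)) n) *
  ∑ k ∈ Finset.range (n + 1),
    qpC q ((q : ℂ) ^ (-(n : ℤ))) k * qpC q (-(q : ℂ) / (t1 * z)) k *
      qpC q ((q : ℂ) * z / t1) k /
      (qpC q (q : ℂ) k * qpC q (-(q : ℂ) ^ 2 / (t1 * t3)) k *
        qpC q (-(q : ℂ) ^ 2 / (t1 * t2)) k) *
      (-(q : ℂ) ^ (n + 2) / (t2 * t3)) ^ k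

/-- The factors of `(a;q)_∞` differ from `1` by an absolutely summable sequence. -/
lemma summable_norm_neg_mul_pow {q : ℝ} (hq0 : 0 < q) (hq1 : q < 1) (a : ℂ) :
    Summable (fun j : ℕ => ‖-(a * (q : ℂ) ^ j)‖) := by
  have h : Summable (fun j : ℕ => ‖a‖ * q ^ j) :=
    (summable_geometric_of_lt_one hq0.le hq1).mul_left _
  refine h.congr fun j => ?_
  simp [abs_of_pos hq0]

lemma tendsto_qpC {q : ℝ} (hq0 : 0 < q) (hq1 : q < 1) (a : ℂ) :
    Tendsto (qpC q a) atTop (𝓝 (qpiC q a)) := by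
  have h := (multipliable_one_add_of_summable
    (summable_norm_neg_mul_pow hq0 hq1 a)).tendsto_prod_tprod_nat
  simpa only [← sub_eq_add_neg] using! h

lemma qpiC_ne_zero {q : ℝ} (hq0 : 0 < q) (hq1 : q < 1) {a : ℂ} (h : ∀ k, qpC q a k ≠ 0) :
    qpiC q a ≠ 0 := by
  have h1 := tprod_one_add_ne_zero_of_summable (f := fun j : ℕ => -(a * (q : ℂ) ^ j))
    (fun i => by
      have := h (i + 1)
      rw [qpC, prod_range_succ] at this
      simpa only [← sub_eq_add_neg] using right_ne_zero_of_mul this)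
    (summable_norm_neg_mul_pow hq0 hq1 a)
  simpa only [← sub_eq_add_neg] using! h1

lemma qpC_succ (q : ℝ) (a : ℂ) (k : ℕ) : qpC q a (k + 1) = qpC q a k * (1 - a * (q : ℂ) ^ k) :=
  prod_range_succ _ _

lemma tendsto_ofReal_pow_zero {q : ℝ} (hq0 : 0 < q) (hq1 : q < 1) :
    Tendsto (fun k : ℕ => (q : ℂ) ^ k) atTop (𝓝 0) :=
  tendsto_pow_atTop_nhds_zero_of_norm_lt_one (by simpa [abs_of_pos hq0] using hq1)

/-- Absolute convergence of the nonterminating `₂φ₂` series. -/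
lemma summable_norm_twoPhiTwo {q : ℝ} (hq0 : 0 < q) (hq1 : q < 1) (a b c d w : ℂ) :
    Summable (fun k : ℕ =>
      ‖qpC q a k * qpC q b k / (qpC q (q : ℂ) k * qpC q c k * qpC q d k) *
        (q : ℂ) ^ (k * (k - 1) / 2) * w ^ k‖) := by
  set R : ℕ → ℂ := fun k =>
    (1 - a * (q : ℂ) ^ k) * (1 - b * (q : ℂ) ^ k) /
      ((1 - q * (q : ℂ) ^ k) * (1 - c * (q : ℂ) ^ k) * (1 - d * (q : ℂ) ^ k)) *
      (q : ℂ) ^ k * w with hR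
  have hlim : Tendsto R atTop (𝓝 0) := by
    have hp := tendsto_ofReal_pow_zero hq0 hq1
    have hf (a : ℂ) : Tendsto (fun k : ℕ => 1 - a * (q : ℂ) ^ k) atTop (𝓝 1) := by
      simpa using (hp.const_mul a).const_sub 1
    simpa using ((((hf a).mul (hf b)).div (((hf q).mul (hf c)).mul (hf d))
      (by simp)).mul hp).mul_const w
  have hev : ∀ᶠ k in atTop, ‖R k‖ ≤ 1 / 2 := by
    have := hlim.norm
    rw [norm_zero] at this
    exact (this.eventually_lt_const (by norm_num)).mono fun _ h => h.le
  refine summable_of_ratio_norm_eventually_le (r := 1 / 2) (by norm_num) ?_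
  filter_upwards [hev] with k hk
  rw [norm_norm, norm_norm]
  refine le_trans (le_of_eq ?_) (mul_le_mul_of_nonneg_right hk (norm_nonneg _))
  rw [← norm_mul]
  congr 1
  simp only [hR, qpC_succ, Nat.triangle_succ, pow_add, pow_one, div_eq_mul_inv, mul_inv]
  ring

lemma qpC_zpow_neg_mul_pow {q : ℝ} (hq0 : 0 < q) (s : ℂ) (n k : ℕ) :
    qpC q ((q : ℂ) ^ (-(n : ℤ))) k * (-(q : ℂ) ^ (n + 2) / s) ^ k =
      (∏ j ∈ range k, ((q : ℂ) ^ j - (q : ℂ) ^ n)) * ((q : ℂ) ^ 2 / s) ^ k := by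
  have hq : (q : ℂ) ^ n ≠ 0 := pow_ne_zero _ (by exact_mod_cast hq0.ne')
  rw [show -(q : ℂ) ^ (n + 2) / s = -(q : ℂ) ^ n * ((q : ℂ) ^ 2 / s) by ring, mul_pow, ← mul_assoc,
    qpC]
  congr 1
  nth_rewrite 2 [← card_range k]
  rw [← prod_const, ← prod_mul_distrib]
  refine prod_congr rfl fun j _ => ?_
  rw [zpow_neg, zpow_natCast]
  field_simp
  ring

lemma prod_range_pow_id (x : ℂ) (k : ℕ) : ∏ j ∈ range k, x ^ j = x ^ (k * (k - 1) / 2) := by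
  rw [prod_pow_eq_pow_sum, sum_range_id]

lemma prod_pow_sub_pow_eq_zero (x : ℂ) {n k : ℕ} (h : n < k) :
    ∏ j ∈ range k, (x ^ j - x ^ n) = 0 :=
  prod_eq_zero (mem_range.2 h) (sub_self _)

lemma norm_prod_pow_sub_pow_le {q : ℝ} (hq0 : 0 < q) (hq1 : q < 1) (n k : ℕ) :
    ‖∏ j ∈ range k, ((q : ℂ) ^ j - (q : ℂ) ^ n)‖ ≤ ‖(q : ℂ) ^ (k * (k - 1) / 2)‖ := by
  rcases lt_or_ge n k with h | h
  · simp [prod_pow_sub_pow_eq_zero _ h]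
  · rw [← prod_range_pow_id, norm_prod, norm_prod]
    refine prod_le_prod (fun _ _ => norm_nonneg _) fun j hj => ?_
    have hjn : q ^ n ≤ q ^ j :=
      pow_le_pow_of_le_one hq0.le hq1.le ((mem_range.1 hj).le.trans h)
    have hn : 0 < q ^ n := pow_pos hq0 n
    rw [← Complex.ofReal_pow, ← Complex.ofReal_pow, ← Complex.ofReal_sub, Complex.norm_real,
      Complex.norm_real, Real.norm_of_nonneg (by linarith), Real.norm_of_nonneg (by linarith)]
    linarith

lemma tendsto_prod_pow_sub_pow {q : ℝ} (hq0 : 0 < q) (hq1 : q < 1) (k : ℕ) :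
    Tendsto (fun n : ℕ => ∏ j ∈ range k, ((q : ℂ) ^ j - (q : ℂ) ^ n)) atTop
      (𝓝 ((q : ℂ) ^ (k * (k - 1) / 2))) := by
  rw [← prod_range_pow_id]
  refine tendsto_finsetProd _ fun j _ => ?_
  simpa using (tendsto_ofReal_pow_zero hq0 hq1).const_sub ((q : ℂ) ^ j)

/-- Termwise passage to the limit in a terminating `₃φ₂` sum with dominating series. -/
lemma tendsto_sum_prod_pow_sub_pow {q : ℝ} (hq0 : 0 < q) (hq1 : q < 1) (C W : ℕ → ℂ)
    (hs : Summable (fun k : ℕ => ‖C k * (q : ℂ) ^ (k * (k - 1) / 2) * W k‖)) :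
    Tendsto (fun n : ℕ => ∑ k ∈ range (n + 1),
        C k * (∏ j ∈ range k, ((q : ℂ) ^ j - (q : ℂ) ^ n)) * W k) atTop
      (𝓝 (∑' k : ℕ, C k * (q : ℂ) ^ (k * (k - 1) / 2) * W k)) := by
  have h := tendsto_tsum_of_dominated_convergence (𝓕 := atTop)
    (f := fun n k : ℕ => C k * (∏ j ∈ range k, ((q : ℂ) ^ j - (q : ℂ) ^ n)) * W k) hs
    (fun k => ((tendsto_prod_pow_sub_pow hq0 hq1 k).const_mul (C k)).mul_const (W k))
    (Eventually.of_forall fun n k => by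
      simp only [norm_mul (_ * _), norm_mul (C k)]
      gcongr
      exact norm_prod_pow_sub_pow_le hq0 hq1 n k)
  refine h.congr fun n => tsum_eq_sum fun k hk => ?_
  rw [prod_pow_sub_pow_eq_zero _ (by simpa [Nat.lt_succ_iff] using hk)]
  simp

theorem pointwise_asymptotics_V
    (q : ℝ) (hq0 : 0 < q) (hq1 : q < 1) (t1 t2 t3 z : ℂ)
    (ht1 : t1 ≠ 0) (ht2 : t2 ≠ 0) (ht3 : t3 ≠ 0) (hz : z ≠ 0)
    (hne : ∀ k : ℕ,
      qpC q (-(q : ℂ) ^ 2 / (t1 * t2)) k ≠ 0 ∧ qpC q (-(q : ℂ) ^ 2 / (t1 * t3)) k ≠ 0 ∧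
      qpC q (-(q : ℂ) ^ 2 / (t2 * t3)) k ≠ 0) :
    Summable (fun k : ℕ =>
      ‖qpC q (-(q : ℂ) / (t1 * z)) k * qpC q ((q : ℂ) * z / t1) k /
          (qpC q (q : ℂ) k * qpC q (-(q : ℂ) ^ 2 / (t1 * t3)) k *
            qpC q (-(q : ℂ) ^ 2 / (t1 * t2)) k) *
        (q : ℂ) ^ (k * (k - 1) / 2) * ((q : ℂ) ^ 2 / (t2 * t3)) ^ k‖) ∧
    Filter.Tendsto
      (fun n : ℕ => (q : ℂ) ^ n * t1 ^ (-(n : ℤ)) * VzC q t1 t2 t3 n z)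
      Filter.atTop
      (nhds
        ((qpiC q (-(q : ℂ) ^ 2 / (t1 * t3)) / qpiC q (-(q : ℂ) ^ 2 / (t2 * t3))) *
          ∑' k : ℕ,
            qpC q (-(q : ℂ) / (t1 * z)) k * qpC q ((q : ℂ) * z / t1) k /
                (qpC q (q : ℂ) k * qpC q (-(q : ℂ) ^ 2 / (t1 * t3)) k *
                  qpC q (-(q : ℂ) ^ 2 / (t1 * t2)) k) *
              (q : ℂ) ^ (k * (k - 1) / 2) * ((q : ℂ) ^ 2 / (t2 * t3)) ^ k)) := by
  have hs := summable_norm_twoPhiTwo hq0 hq1 (-(q : ℂ) / (t1 * z)) ((q : ℂ) * z / t1)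
    (-(q : ℂ) ^ 2 / (t1 * t3)) (-(q : ℂ) ^ 2 / (t1 * t2)) ((q : ℂ) ^ 2 / (t2 * t3))
  refine ⟨hs, ?_⟩
  have hpre := (tendsto_qpC hq0 hq1 (-(q : ℂ) ^ 2 / (t1 * t3))).div
    (tendsto_qpC hq0 hq1 (-(q : ℂ) ^ 2 / (t2 * t3)))
    (qpiC_ne_zero hq0 hq1 fun k => (hne k).2.2)
  refine (hpre.mul (tendsto_sum_prod_pow_sub_pow hq0 hq1 _ _ hs)).congr fun n => ?_
  have hq : (q : ℂ) ≠ 0 := by exact_mod_cast hq0.ne'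
  have hone : (q : ℂ) ^ n * t1 ^ (-(n : ℤ)) * (t1 / (q : ℂ)) ^ n = 1 := by
    rw [zpow_neg, zpow_natCast, div_pow]
    field_simp
  rw [VzC, ← mul_assoc, ← mul_assoc, hone, one_mul]
  congr 1
  refine sum_congr rfl fun k _ => ?_
  rw [mul_assoc, ← qpC_zpow_neg_mul_pow hq0]
  ring
end
end

section
/- Soft-edge Plancherel–Rotach asymptotics: let t₁, t₂, t₃ be nonzero real numbers and s a nonzero real number (with all q-shifted factorials appearing below nonzero). For each n let V̆_n(q^{−2n}/s) denote V_n evaluated with z = q^{−2n}/s in its defining formula, i.e. at the point x_n(s) = (q^{−2n}/s − q^{2n}s)/2. Then lim_{n→∞} (−s t₂ t₃)^n q^{n²−n} V̆_n(q^{−2n}/s) = A_q(s t₁ t₂ t₃ q^{−2}) / [(−q²/(t₁t₂);q)_∞ (−q²/(t₂t₃);q)_∞]. -/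
noncomputable section

open scoped BigOperators
open Finset MeasureTheory Filter Topology

/-- The polynomial `V_n` as a function of the variable `z`. -/
def VzR (q t1 t2 t3 : ℝ) (n : ℕ) (z : ℝ) : ℝ :=
  (t1 / q) ^ n * (qp q (-q ^ 2 / (t1 * t3)) n / qp q (-q ^ 2 / (t2 * t3)) n) *
  ∑ k ∈ Finset.range (n + 1),
    qp q (q ^ (-(n : ℤ))) k * qp q (-q / (t1 * z)) k * qp q (q * z / t1) k /
      (qp q q k * qp q (-q ^ 2 / (t1 * t3)) k * qp q (-q ^ 2 / (t1 * t2)) k) *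
      (-q ^ (n + 2) / (t2 * t3)) ^ k

/-- The Ramanujan (q-Airy) function `A_q`. -/
def ramanujanAq (q w : ℝ) : ℝ := ∑' n : ℕ, q ^ (n ^ 2) * (-w) ^ n / qp q q n

theorem summable_neg_mul_pow {q : ℝ} (hq0 : 0 < q) (hq1 : q < 1) (a : ℝ) :
    Summable fun j : ℕ => ‖-(a * q ^ j)‖ :=
  ((summable_geometric_of_lt_one hq0.le hq1).mul_left a).neg.norm

theorem tendsto_qp_qpi {q : ℝ} (hq0 : 0 < q) (hq1 : q < 1) (a : ℝ) :
    Tendsto (qp q a) atTop (𝓝 (qpi q a)) := by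
  have h := (multipliable_one_add_of_summable
    (summable_neg_mul_pow hq0 hq1 a)).hasProd.tendsto_prod_nat
  simp only [← sub_eq_add_neg] at h
  exact h

theorem qpi_ne_zero {q : ℝ} (hq0 : 0 < q) (hq1 : q < 1) {a : ℝ} (h : ∀ k, qp q a k ≠ 0) :
    qpi q a ≠ 0 := by
  have h1 := tprod_one_add_ne_zero_of_summable (f := fun j : ℕ => -(a * q ^ j)) (fun j => by
    have := h (j + 1)
    rw [qp, Finset.prod_range_succ] at this
    simpa only [← sub_eq_add_neg] using right_ne_zero_of_mul this)
    (summable_neg_mul_pow hq0 hq1 a)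
  simp only [← sub_eq_add_neg] at h1
  exact h1

theorem abs_qp_sub_one_le {q : ℝ} (hq0 : 0 < q) (hq1 : q < 1) (a : ℝ) (k : ℕ) :
    |qp q a k - 1| ≤ Real.exp (|a| * (1 - q)⁻¹) - 1 := by
  have h := Finset.norm_prod_one_add_sub_one_le (Finset.range k) (fun j : ℕ => -(a * q ^ j))
  simp only [← sub_eq_add_neg, Real.norm_eq_abs] at h
  refine h.trans (sub_le_sub_right (Real.exp_le_exp.mpr ?_) 1)
  simp only [abs_neg, abs_mul, abs_pow, abs_of_pos hq0, ← Finset.mul_sum]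
  refine mul_le_mul_of_nonneg_left ?_ (abs_nonneg a)
  rw [← tsum_geometric_of_lt_one hq0.le hq1]
  exact (summable_geometric_of_lt_one hq0.le hq1).sum_le_tsum _ fun j _ => by positivity

theorem abs_qp_mul_pow_le {q : ℝ} (hq0 : 0 < q) (hq1 : q < 1) (a : ℝ) (N k : ℕ) :
    |qp q (a * q ^ N) k| ≤ Real.exp (|a| * (1 - q)⁻¹) := by
  have h := abs_qp_sub_one_le hq0 hq1 (a * q ^ N) k
  have h2 : |a * q ^ N| ≤ |a| := by
    rw [abs_mul, abs_of_pos (pow_pos hq0 N)]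
    exact mul_le_of_le_one_right (abs_nonneg a) (pow_le_one₀ hq0.le hq1.le)
  have h3 : Real.exp (|a * q ^ N| * (1 - q)⁻¹) ≤ Real.exp (|a| * (1 - q)⁻¹) :=
    Real.exp_le_exp.mpr (mul_le_mul_of_nonneg_right h2 (inv_nonneg.mpr (by linarith)))
  have h4 := abs_add_le (qp q (a * q ^ N) k - 1) 1
  rw [sub_add_cancel, abs_one] at h4
  linarith

theorem tendsto_qp_mul_pow_one {q : ℝ} (hq0 : 0 < q) (hq1 : q < 1) (a : ℝ) {N : ℕ → ℕ}
    (hN : Tendsto N atTop atTop) (k : ℕ → ℕ) :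
    Tendsto (fun n => qp q (a * q ^ N n) (k n)) atTop (𝓝 1) := by
  have hp : Tendsto (fun n => q ^ N n) atTop (𝓝 0) :=
    (tendsto_pow_atTop_nhds_zero_of_lt_one hq0.le hq1).comp hN
  have h0 : Tendsto (fun n => Real.exp (|a * q ^ N n| * (1 - q)⁻¹) - 1) atTop (𝓝 0) := by
    have := (Real.continuous_exp.tendsto _).comp (((hp.const_mul a).abs).mul_const (1 - q)⁻¹)
    simpa using this.sub_const 1
  rw [tendsto_iff_norm_sub_tendsto_zero]
  exact squeeze_zero (fun _ => norm_nonneg _)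
    (fun n => abs_qp_sub_one_le hq0 hq1 (a * q ^ N n) (k n)) h0

theorem qp_eq_reflect {q : ℝ} (hq : q ≠ 0) {a b : ℝ} (k : ℕ) (hab : a * b * q ^ k = q) :
    qp q a k = (-a) ^ k * (∏ j ∈ Finset.range k, q ^ j) * qp q b k := by
  have ha : a ≠ 0 := by
    rintro rfl
    simp at hab
    exact hq hab.symm
  have hr : qp q b k = ∏ j ∈ Finset.range k, (1 - b * q ^ (k - 1 - j)) :=
    (Finset.prod_range_reflect (fun j => 1 - b * q ^ j) k).symm
  rw [hr, ← Finset.card_range k, ← Finset.prod_const, Finset.card_range,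
    ← Finset.prod_mul_distrib, ← Finset.prod_mul_distrib, qp]
  refine Finset.prod_congr rfl fun j hj => ?_
  obtain ⟨i, rfl⟩ := Nat.exists_eq_add_of_lt (Finset.mem_range.mp hj)
  have e : j + i + 1 - 1 - j = i := by omega
  rw [e]
  have h1 : a * b * q ^ (j + i) = 1 := by
    apply mul_right_cancel₀ hq
    rw [one_mul, mul_assoc, ← pow_succ, hab]
  rw [pow_add] at h1
  linear_combination (-1 : ℝ) * h1

theorem prod_pow_sq_mul_pow (q : ℝ) (k : ℕ) :
    (∏ j ∈ Finset.range k, q ^ j) ^ 2 * q ^ k = q ^ (k ^ 2) := by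
  rw [Finset.prod_pow_eq_pow_sum, ← pow_mul, ← pow_add, Finset.sum_range_id_mul_two]
  congr 1
  cases k with
  | zero => rfl
  | succ k => simp; ring

theorem qp_add (q a : ℝ) (m k : ℕ) : qp q a (m + k) = qp q a m * qp q (a * q ^ m) k := by
  simp only [qp, Finset.prod_range_add, pow_add, mul_assoc]

theorem summable_pow_sq_mul_pow {q : ℝ} (hq0 : 0 < q) (hq1 : q < 1) (w : ℝ) :
    Summable fun m : ℕ => q ^ (m ^ 2) * |w| ^ m := by
  have h : Tendsto (fun m : ℕ => q ^ m * |w|) atTop (𝓝 0) := by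
    simpa using (tendsto_pow_atTop_nhds_zero_of_lt_one hq0.le hq1).mul_const |w|
  refine Summable.of_norm_bounded_eventually_nat (g := fun m : ℕ => (1 / 2 : ℝ) ^ m)
    summable_geometric_two ?_
  filter_upwards [h.eventually_le_const (show (0 : ℝ) < 1 / 2 by norm_num)] with m hm
  rw [Real.norm_of_nonneg (by positivity), sq, pow_mul, ← mul_pow]
  exact pow_le_pow_left₀ (by positivity) hm m

theorem exists_abs_le_of_tendsto {u : ℕ → ℝ} {l : ℝ} (h : Tendsto u atTop (𝓝 l)) :
    ∃ C, 0 ≤ C ∧ ∀ n, |u n| ≤ C := by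
  obtain ⟨C, hC⟩ := (Metric.isBounded_range_of_tendsto u h).exists_norm_le
  exact ⟨C, (norm_nonneg _).trans (hC _ ⟨0, rfl⟩), fun n => hC _ ⟨n, rfl⟩⟩

/-- The numerator of the summand of index `k` of the rescaled `V_{m+k}`, with its dominant powers
factored out. -/
theorem rescaled_numerator_eq {q : ℝ} (hq0 : 0 < q) (hq1 : q < 1) {t1 t2 t3 s : ℝ}
    (ht1 : t1 ≠ 0) (ht2 : t2 ≠ 0) (ht3 : t3 ≠ 0) (hs : s ≠ 0) (m k : ℕ) :
    (-(s * t2 * t3)) ^ (m + k) * q ^ (((m + k : ℕ) : ℤ) ^ 2 - ((m + k : ℕ) : ℤ)) *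
      (t1 / q) ^ (m + k) *
      (qp q (q ^ (-((m + k : ℕ) : ℤ))) k *
        qp q (-q / (t1 * (q ^ (-(2 * ((m + k : ℕ) : ℤ))) / s))) k *
        qp q (q * (q ^ (-(2 * ((m + k : ℕ) : ℤ))) / s) / t1) k) *
      (-q ^ (m + k + 2) / (t2 * t3)) ^ k =
    q ^ (m ^ 2) * (-(s * t1 * t2 * t3 / q ^ 2)) ^ m / qp q q m * qp q q (m + k) *
      qp q (-(s * q / t1) * q ^ (2 * (m + k))) k * qp q (s * t1 * q ^ (2 * m + k)) k := by
  have hq : q ≠ 0 := hq0.ne'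
  have e1 : q ^ (-((m + k : ℕ) : ℤ)) = (q ^ (m + k))⁻¹ := by rw [zpow_neg, zpow_natCast]
  have e2 : q ^ (-(2 * ((m + k : ℕ) : ℤ))) = (q ^ (2 * (m + k)))⁻¹ := by
    rw [zpow_neg, ← zpow_natCast q (2 * (m + k))]
    push_cast
    rfl
  have e3 : q ^ (((m + k : ℕ) : ℤ) ^ 2 - ((m + k : ℕ) : ℤ)) = q ^ ((m + k) ^ 2) / q ^ (m + k) := by
    rw [zpow_sub₀ hq, zpow_natCast, ← zpow_natCast q ((m + k) ^ 2)]
    push_cast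
    rfl
  rw [e1, e2, e3]
  rw [qp_eq_reflect hq (a := (q ^ (m + k))⁻¹) (b := q * q ^ m) k (by rw [pow_add]; field_simp),
    qp_eq_reflect hq (a := q * ((q ^ (2 * (m + k)))⁻¹ / s) / t1) (b := s * t1 * q ^ (2 * m + k)) k
      (by field_simp; ring), qp_add q q m k]
  have e4 : -q / (t1 * ((q ^ (2 * (m + k)))⁻¹ / s)) = -(s * q / t1) * q ^ (2 * (m + k)) := by
    field_simp
  rw [e4]
  have hm := qp_self_ne_zero hq0 hq1 m
  have hT := prod_pow_sq_mul_pow q k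
  generalize (∏ j ∈ Finset.range k, q ^ j) = T at hT ⊢
  generalize qp q (-(s * q / t1) * q ^ (2 * (m + k))) k = X
  generalize qp q (s * t1 * q ^ (2 * m + k)) k = Y
  generalize qp q (q * q ^ m) k = Z
  generalize qp q q m = W at hm ⊢
  suffices h : (-(s * t2 * t3)) ^ (m + k) * (q ^ ((m + k) ^ 2) / q ^ (m + k)) *
      (t1 / q) ^ (m + k) * ((-(q ^ (m + k))⁻¹) ^ k *
      (-(q * ((q ^ (2 * (m + k)))⁻¹ / s) / t1)) ^ k) * (-q ^ (m + k + 2) / (t2 * t3)) ^ k * T ^ 2 =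
      q ^ (m ^ 2) * (-(s * t1 * t2 * t3 / q ^ 2)) ^ m by
    rw [← h]
    field_simp
  have hT2 : T ^ 2 = q ^ (k ^ 2) / q ^ k := by rw [← hT]; field_simp
  rw [hT2]
  have h1 : (-(q ^ (m + k))⁻¹) ^ k * (-(q * ((q ^ (2 * (m + k)))⁻¹ / s) / t1)) ^ k *
      (-q ^ (m + k + 2) / (t2 * t3)) ^ k = (-(s * t1 * t2 * t3))⁻¹ ^ k * (q ^ 3) ^ k /
        (q ^ (2 * (m + k))) ^ k := by
    rw [← mul_pow, ← mul_pow, ← mul_pow, ← div_pow]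
    congr 1
    field_simp
    ring
  have h2 : (-(s * t2 * t3)) ^ (m + k) * (t1 / q) ^ (m + k) =
      (-(s * t1 * t2 * t3)) ^ m * (-(s * t1 * t2 * t3)) ^ k / q ^ (m + k) := by
    rw [← mul_pow, ← pow_add, ← div_pow]
    congr 1
    field_simp
  have h3 : (-(s * t1 * t2 * t3 / q ^ 2)) ^ m = (-(s * t1 * t2 * t3)) ^ m / (q ^ 2) ^ m := by
    rw [← div_pow]
    congr 1
    field_simp
  have hA : -(s * t1 * t2 * t3) ≠ 0 := by
    rw [neg_ne_zero]
    positivity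
  rw [h3]
  generalize -(s * t1 * t2 * t3) = A at h1 h2 hA ⊢
  calc _ = ((-(s * t2 * t3)) ^ (m + k) * (t1 / q) ^ (m + k)) *
        ((-(q ^ (m + k))⁻¹) ^ k * (-(q * ((q ^ (2 * (m + k)))⁻¹ / s) / t1)) ^ k *
          (-q ^ (m + k + 2) / (t2 * t3)) ^ k) * (q ^ ((m + k) ^ 2) / q ^ (m + k)) *
        (q ^ (k ^ 2) / q ^ k) := by ring
    _ = _ := by
      rw [h1, h2, inv_pow]
      field_simp
      ring

theorem soft_edge_asymptotics_V
    (q : ℝ) (hq0 : 0 < q) (hq1 : q < 1) (t1 t2 t3 s : ℝ)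
    (ht1 : t1 ≠ 0) (ht2 : t2 ≠ 0) (ht3 : t3 ≠ 0) (hs : s ≠ 0)
    (hne : ∀ k : ℕ,
      qp q (-q ^ 2 / (t1 * t2)) k ≠ 0 ∧ qp q (-q ^ 2 / (t1 * t3)) k ≠ 0 ∧
      qp q (-q ^ 2 / (t2 * t3)) k ≠ 0) :
    Filter.Tendsto
      (fun n : ℕ =>
        (-(s * t2 * t3)) ^ n * q ^ ((n : ℤ) ^ 2 - (n : ℤ)) *
          VzR q t1 t2 t3 n (q ^ (-(2 * (n : ℤ))) / s))
      Filter.atTop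
      (nhds
        (ramanujanAq q (s * t1 * t2 * t3 / q ^ 2) /
          (qpi q (-q ^ 2 / (t1 * t2)) * qpi q (-q ^ 2 / (t2 * t3))))) := by
  set P12 := qp q (-q ^ 2 / (t1 * t2)) with hP12
  set P13 := qp q (-q ^ 2 / (t1 * t3)) with hP13
  set P23 := qp q (-q ^ 2 / (t2 * t3)) with hP23
  set w := s * t1 * t2 * t3 / q ^ 2 with hw
  have n12 : qpi q (-q ^ 2 / (t1 * t2)) ≠ 0 := qpi_ne_zero hq0 hq1 fun k => (hne k).1
  have n13 : qpi q (-q ^ 2 / (t1 * t3)) ≠ 0 := qpi_ne_zero hq0 hq1 fun k => (hne k).2.1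
  have n23 : qpi q (-q ^ 2 / (t2 * t3)) ≠ 0 := qpi_ne_zero hq0 hq1 fun k => (hne k).2.2
  have nq : qpi q q ≠ 0 := qpi_ne_zero hq0 hq1 (qp_self_ne_zero hq0 hq1)
  have l12 := tendsto_qp_qpi hq0 hq1 (-q ^ 2 / (t1 * t2))
  have l13 := tendsto_qp_qpi hq0 hq1 (-q ^ 2 / (t1 * t3))
  have l23 := tendsto_qp_qpi hq0 hq1 (-q ^ 2 / (t2 * t3))
  have lq := tendsto_qp_qpi hq0 hq1 q
  rw [← hP12] at l12
  rw [← hP13] at l13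
  rw [← hP23] at l23
  have lU := (l13.div l23 n23).mul lq
  have lW := ((lq.mul l13).mul l12).inv₀ (mul_ne_zero (mul_ne_zero nq n13) n12)
  obtain ⟨CU, hCU0, hCU⟩ := exists_abs_le_of_tendsto lU
  obtain ⟨CW, hCW0, hCW⟩ := exists_abs_le_of_tendsto lW
  obtain ⟨Cq, hCq0, hCq⟩ := exists_abs_le_of_tendsto (lq.inv₀ nq)
  let R : ℕ → ℕ → ℝ := fun n m => (P13 n / P23 n * qp q q n) *
    (qp q q (n - m) * P13 (n - m) * P12 (n - m))⁻¹ *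
    qp q (-(s * q / t1) * q ^ (2 * n)) (n - m) * qp q (s * t1 * q ^ (n + m)) (n - m)
  let F : ℕ → ℕ → ℝ := fun n m =>
    if m ≤ n then q ^ (m ^ 2) * (-w) ^ m / qp q q m * R n m else 0
  have hF : ∀ n : ℕ, (-(s * t2 * t3)) ^ n * q ^ ((n : ℤ) ^ 2 - (n : ℤ)) *
      VzR q t1 t2 t3 n (q ^ (-(2 * (n : ℤ))) / s) = ∑' m, F n m := by
    intro n
    rw [tsum_eq_sum (s := Finset.range (n + 1)) (fun m hm => if_neg (by simpa using hm)),
      VzR, ← Finset.sum_flip, Finset.mul_sum, Finset.mul_sum]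
    refine Finset.sum_congr rfl fun m hm => ?_
    have hmn : m ≤ n := by simpa [Nat.lt_succ_iff] using hm
    obtain ⟨k, rfl⟩ := Nat.exists_eq_add_of_le hmn
    have h := rescaled_numerator_eq hq0 hq1 ht1 ht2 ht3 hs m k
    simp only [R, if_pos hmn, Nat.add_sub_cancel_left]
    rw [show m + k + m = 2 * m + k by ring]
    rw [← hw] at h
    rw [← hP12, ← hP13, ← hP23]
    linear_combination (P13 (m + k) / P23 (m + k) * (qp q q k * P13 k * P12 k)⁻¹) * h
  simp only [hF]
  have hlim : ramanujanAq q w / (qpi q (-q ^ 2 / (t1 * t2)) * qpi q (-q ^ 2 / (t2 * t3))) =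
      ∑' m : ℕ, q ^ (m ^ 2) * (-w) ^ m / qp q q m *
        (qpi q (-q ^ 2 / (t1 * t2)) * qpi q (-q ^ 2 / (t2 * t3)))⁻¹ := by
    rw [tsum_mul_right, ramanujanAq, div_eq_mul_inv]
  rw [hlim]
  let EX := Real.exp (|-(s * q / t1)| * (1 - q)⁻¹)
  let EY := Real.exp (|s * t1| * (1 - q)⁻¹)
  refine tendsto_tsum_of_dominated_convergence
    (bound := fun m : ℕ => q ^ (m ^ 2) * |w| ^ m * (Cq * (CU * CW * EX * EY)))
    ((summable_pow_sq_mul_pow hq0 hq1 w).mul_right _) (fun m => ?_) (Eventually.of_forall ?_)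
  · have hsub : Tendsto (fun n : ℕ => n - m) atTop atTop := tendsto_sub_atTop_nat m
    have hX := tendsto_qp_mul_pow_one hq0 hq1 (-(s * q / t1)) (N := fun n => 2 * n)
      (tendsto_id.const_mul_atTop' two_pos) (fun n => n - m)
    have hY := tendsto_qp_mul_pow_one hq0 hq1 (s * t1) (N := fun n => n + m)
      (tendsto_add_atTop_nat m) (fun n => n - m)
    have hR := (((lU.mul (lW.comp hsub)).mul hX).mul hY).const_mul
      (q ^ (m ^ 2) * (-w) ^ m / qp q q m)
    have e : qpi q (-q ^ 2 / (t1 * t3)) / qpi q (-q ^ 2 / (t2 * t3)) * qpi q q *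
        (qpi q q * qpi q (-q ^ 2 / (t1 * t3)) * qpi q (-q ^ 2 / (t1 * t2)))⁻¹ * 1 * 1 =
        (qpi q (-q ^ 2 / (t1 * t2)) * qpi q (-q ^ 2 / (t2 * t3)))⁻¹ := by
      generalize qpi q (-q ^ 2 / (t1 * t2)) = a at *
      generalize qpi q (-q ^ 2 / (t1 * t3)) = b at *
      generalize qpi q (-q ^ 2 / (t2 * t3)) = c at *
      field_simp
    rw [e] at hR
    refine hR.congr' ?_
    filter_upwards [eventually_ge_atTop m] with n hn
    simp only [F, R, if_pos hn]
    rfl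
  · intro n m
    by_cases hmn : m ≤ n
    · simp only [F, R, if_pos hmn, Real.norm_eq_abs]
      have h1 := hCU n
      have h2 := hCW (n - m)
      have h3 := hCq m
      have h4 := abs_qp_mul_pow_le hq0 hq1 (-(s * q / t1)) (2 * n) (n - m)
      have h5 := abs_qp_mul_pow_le hq0 hq1 (s * t1) (n + m) (n - m)
      simp only [Pi.div_apply] at h1
      rw [div_eq_mul_inv, mul_assoc (q ^ (m ^ 2) * (-w) ^ m), abs_mul (q ^ (m ^ 2) * (-w) ^ m),
        abs_mul (q ^ (m ^ 2)), abs_pow (-w), abs_neg w, abs_of_pos (pow_pos hq0 (m ^ 2)),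
        abs_mul (qp q q m)⁻¹, abs_mul _ (qp q (s * t1 * q ^ (n + m)) (n - m)),
        abs_mul _ (qp q (-(s * q / t1) * q ^ (2 * n)) (n - m)),
        abs_mul (P13 n / P23 n * qp q q n)]
      gcongr
    · simp only [F, if_neg hmn, norm_zero]
      positivity
end
end
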